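/- arXiv:1403.6347 — 2 statements merged into one kernel-verified Lean document; each statement's English description precedes it below -/
import Mathlib

section
/- Let G be a graph, c a proper 3-colouring of G, and S ⊆ V(G) a set of vertices such that every vertex v ∈ S has, within the induced subgraph G[S], at least one neighbour of each of the two colours different from c(v). Then every vertex of S is fixed with respect to c, i.e., no sequence of single-vertex recolourings through proper 3-colourings starting from c can ever change the colour of a vertex in S. -/
/-- A colouring is proper if adjacent vertices receive different colours. -/
def ProperColouring {V α : Type*} (G : SimpleGraph V) (c : V → α) : Prop :=
  ∀ u v : V, G.Adj u v → c u ≠ c v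

/-- A single-vertex recolouring step: the new colouring is proper and differs
from the old one on exactly one vertex. -/
def RecolStep {V α : Type*} (G : SimpleGraph V) (c d : V → α) : Prop :=
  ProperColouring G d ∧ ∃ x : V, c x ≠ d x ∧ ∀ v : V, v ≠ x → c v = d v

/-- if every vertex `v` of a set `S` has, inside the induced
subgraph `G[S]`, a neighbour of each of the two colours different from `c v`,
then every vertex of `S` is fixed with respect to `c`: no sequence of
single-vertex recolourings through proper 3-colourings starting at `c` changes
the colour of a vertex of `S`. -/
theorem stmt_6 {V : Type*} (G : SimpleGraph V) (c : V → ZMod 3)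
    (hc : ProperColouring G c) (S : Set V)
    (hS : ∀ v ∈ S, ∀ b : ZMod 3, b ≠ c v → ∃ w ∈ S, G.Adj v w ∧ c w = b) :
    ∀ c' : V → ZMod 3, Relation.ReflTransGen (RecolStep G) c c' →
      ∀ v ∈ S, c' v = c v := by
  intro c' h
  induction h with
  | refl => intro v _; rfl
  | tail _ hstep ih =>
    obtain ⟨hd, x, hx, hrest⟩ := hstep
    intro v hv
    by_contra hne
    obtain ⟨w, hwS, hadj, hw⟩ := hS v hv _ hne
    have hvx : v = x := by
      by_contra hvx
      exact hne ((hrest v hvx).symm.trans (ih v hv))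
    have hwx : w ≠ x := by
      rintro rfl
      exact hadj.ne hvx
    exact hd v w hadj (hw.symm.trans ((ih w hwS).symm.trans (hrest w hwx)))
end

section
/- Let G be a graph with a proper 3-colouring c, and suppose the vertices v_1, ..., v_n of G can be ordered so that for each v_j there is a colour d(v_j) ≠ c(v_j) such that no neighbour of v_j among {v_j, v_{j+1}, ..., v_n} has colour d(v_j) under c. Then for every vertex u, there is a sequence of single-vertex recolourings through proper 3-colourings starting at c that changes the colour of u; i.e., no vertex is fixed with respect to c. -/
open Classical in
/-- The colouring after the first `k` vertices have been processed with shift `s`. -/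
noncomputable def shiftCol {V : Type*} {n : ℕ} (e : Fin n ≃ V) (c d : V → ZMod 3)
    (s : ZMod 3) (k : ℕ) : V → ZMod 3 :=
  fun v => if ((e.symm v : Fin n) : ℕ) < k ∧ d v - c v = s then c v + s else c v

theorem zmod3_aux : ∀ a b x y s : ZMod 3, b ≠ y → y - x ≠ 0 → y - x ≠ s → s ≠ 0 → b = a →
    x ≠ a + s := by decide

theorem shiftCol_ne {V : Type*} (G : SimpleGraph V) (c : V → ZMod 3)
    (hc : ProperColouring G c) (n : ℕ) (e : Fin n ≃ V) (d : V → ZMod 3)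
    (hd : ∀ v : V, d v ≠ c v)
    (hnb : ∀ j j' : Fin n, j ≤ j' → G.Adj (e j) (e j') → c (e j') ≠ d (e j))
    (s : ZMod 3) (hs : s ≠ 0) (k : ℕ) (v w : V) (h : G.Adj v w)
    (hv : ((e.symm v : Fin n) : ℕ) < k ∧ d v - c v = s)
    (hw : ¬ (((e.symm w : Fin n) : ℕ) < k ∧ d w - c w = s)) : c w ≠ c v + s := by
  have hdv : c v + s = d v := by rw [← hv.2]; ring
  rcases le_total (e.symm v) (e.symm w) with hle | hle
  · have := hnb _ _ hle (by simpa using h)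
    rw [hdv]; simpa using this
  · have h1 := hnb _ _ hle (by simpa using h.symm)
    have h2 : ((e.symm w : Fin n) : ℕ) < k := lt_of_le_of_lt hle hv.1
    have h3 : d w - c w ≠ s := fun h => hw ⟨h2, h⟩
    exact zmod3_aux (c v) (c v) (c w) (d w) s (by simpa using h1)
      (sub_ne_zero.2 (hd w)) h3 hs rfl

theorem shiftCol_proper {V : Type*} (G : SimpleGraph V) (c : V → ZMod 3)
    (hc : ProperColouring G c) (n : ℕ) (e : Fin n ≃ V) (d : V → ZMod 3)
    (hd : ∀ v : V, d v ≠ c v)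
    (hnb : ∀ j j' : Fin n, j ≤ j' → G.Adj (e j) (e j') → c (e j') ≠ d (e j))
    (s : ZMod 3) (hs : s ≠ 0) (k : ℕ) : ProperColouring G (shiftCol e c d s k) := by
  intro v w h
  unfold shiftCol
  split_ifs with h1 h2 h2
  · intro h3; exact hc v w h (add_right_cancel h3)
  · exact (shiftCol_ne G c hc n e d hd hnb s hs k v w h h1 h2).symm
  · exact shiftCol_ne G c hc n e d hd hnb s hs k w v h.symm h2 h1
  · exact hc v w h

/-- if the vertices can be ordered `v₁,…,vₙ` so that each `v_j`
has a colour `d(v_j) ≠ c(v_j)` not used by `c` on any neighbour of `v_j` among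
`{v_j, v_{j+1}, …, vₙ}`, then no vertex is fixed with respect to the proper
3-colouring `c`: every vertex `u` can be recoloured by some sequence of
single-vertex recolourings through proper 3-colourings starting at `c`. -/
theorem stmt_7 {V : Type*} [Fintype V] (G : SimpleGraph V) (c : V → ZMod 3)
    (hc : ProperColouring G c) (n : ℕ) (e : Fin n ≃ V) (d : V → ZMod 3)
    (hd : ∀ v : V, d v ≠ c v)
    (hnb : ∀ j j' : Fin n, j ≤ j' → G.Adj (e j) (e j') → c (e j') ≠ d (e j)) :
    ∀ u : V, ∃ c' : V → ZMod 3,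
      Relation.ReflTransGen (RecolStep G) c c' ∧ c' u ≠ c u := by
  intro u
  have hs : d u - c u ≠ 0 := sub_ne_zero.2 (hd u)
  generalize hsu : d u - c u = s at hs
  have key : ∀ k : ℕ, Relation.ReflTransGen (RecolStep G) c (shiftCol e c d s k) := by
    intro k
    induction k with
    | zero =>
      have : shiftCol e c d s 0 = c := by funext v; simp [shiftCol]
      rw [this]
    | succ k ih =>
      by_cases hx : ∃ x : V, ((e.symm x : Fin n) : ℕ) = k ∧ d x - c x = s
      · obtain ⟨x, hxk, hxs⟩ := hx
        refine ih.tail ⟨shiftCol_proper G c hc n e d hd hnb s hs (k + 1), x, ?_, ?_⟩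
        · simp [shiftCol, hxk, hxs, hs]
        · intro v hv
          have hne : ((e.symm v : Fin n) : ℕ) ≠ k := by
            intro h
            exact hv (e.symm.injective (Fin.ext (h.trans hxk.symm)))
          have : ((e.symm v : Fin n) : ℕ) < k + 1 ↔ ((e.symm v : Fin n) : ℕ) < k := by omega
          simp only [shiftCol, this]
      · have : shiftCol e c d s (k + 1) = shiftCol e c d s k := by
          funext v
          have : (((e.symm v : Fin n) : ℕ) < k + 1 ∧ d v - c v = s) ↔
              (((e.symm v : Fin n) : ℕ) < k ∧ d v - c v = s) := by
            constructor
            · rintro ⟨h1, h2⟩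
              have : ((e.symm v : Fin n) : ℕ) ≠ k := fun h => hx ⟨v, h, h2⟩
              exact ⟨by omega, h2⟩
            · rintro ⟨h1, h2⟩
              exact ⟨by omega, h2⟩
          simp only [shiftCol, this]
        rw [this]; exact ih
  refine ⟨_, key n, ?_⟩
  simp [shiftCol, hsu, hs]
end
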